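/- Let X = MD(G, S0, S1, T0, T1) be a strongly connected mixed Cayley digraph with λ(X) < δ(X), and let A be a λ-atom of X. Then (1) the vertex set of X is a disjoint union of distinct positive λ-atoms of X (and likewise a disjoint union of distinct negative λ-atoms), and (2) |A ∩ X_0| = |A ∩ X_1|. -/

import Mathlib

open Set Pointwise

/-- Arc relation of the mixed Cayley digraph `MD(G,S0,S1,T0,T1)` on vertex set
`G × Bool`, where `false` plays the role of the index `0` and `true` of `1`. -/
def MDArc {G : Type*} [Group G] (S0 S1 T0 T1 : Set G) (u v : G × Bool) : Prop :=
  (u.2 = false ∧ v.2 = false ∧ ∃ s ∈ S0, v.1 = s * u.1) ∨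
  (u.2 = true ∧ v.2 = true ∧ ∃ s ∈ S1, v.1 = s * u.1) ∨
  (u.2 = false ∧ v.2 = true ∧ ∃ t ∈ T0, v.1 = t * u.1) ∨
  (u.2 = true ∧ v.2 = false ∧ ∃ t ∈ T1, u.1 = t * v.1)

/-- A digraph (given by its arc relation) is strongly connected if every vertex
is reachable from every other vertex by a directed path. -/
def DigraphStronglyConnected {V : Type*} (R : V → V → Prop) : Prop :=
  ∀ u v : V, Relation.ReflTransGen R u v

/-- Out-degree of a vertex: the number of arcs originating at it. -/
noncomputable def outDegree {V : Type*} (R : V → V → Prop) (v : V) : ℕ :=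
  {w | R v w}.ncard

/-- In-degree of a vertex: the number of arcs terminating at it. -/
noncomputable def inDegree {V : Type*} (R : V → V → Prop) (v : V) : ℕ :=
  {w | R w v}.ncard

/-- `δ`: the minimum, over all vertices, of in-degrees and out-degrees. -/
noncomputable def minDegree {V : Type*} (R : V → V → Prop) : ℕ :=
  sInf {n | ∃ v, n = outDegree R v ∨ n = inDegree R v}

/-- `W` is an arc-disconnecting set: a set of arcs whose deletion leaves a
digraph that is not strongly connected. -/
def IsDisconnectingArcSet {V : Type*} (R : V → V → Prop) (W : Set (V × V)) : Prop :=
  (∀ p ∈ W, R p.1 p.2) ∧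
  ¬ DigraphStronglyConnected (fun u v => R u v ∧ (u, v) ∉ W)

/-- The arc connectivity `λ`: the minimum cardinality of an arc-disconnecting set. -/
noncomputable def arcConnectivity {V : Type*} (R : V → V → Prop) : ℕ :=
  sInf {n | ∃ W : Set (V × V), IsDisconnectingArcSet R W ∧ W.ncard = n}

/-- `ω⁺(A)`: the set of arcs from `A` to its complement. -/
def omegaPlus {V : Type*} (R : V → V → Prop) (A : Set V) : Set (V × V) :=
  {p | R p.1 p.2 ∧ p.1 ∈ A ∧ p.2 ∉ A}

/-- `ω⁻(A)`: the set of arcs from the complement of `A` to `A`. -/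
def omegaMinus {V : Type*} (R : V → V → Prop) (A : Set V) : Set (V × V) :=
  {p | R p.1 p.2 ∧ p.1 ∉ A ∧ p.2 ∈ A}

/-- A positive arc fragment: a proper nonempty vertex subset with `|ω⁺(A)| = λ`. -/
def IsPosFragment {V : Type*} (R : V → V → Prop) (A : Set V) : Prop :=
  A.Nonempty ∧ A ≠ Set.univ ∧ (omegaPlus R A).ncard = arcConnectivity R

/-- A negative arc fragment: a proper nonempty vertex subset with `|ω⁻(A)| = λ`. -/
def IsNegFragment {V : Type*} (R : V → V → Prop) (A : Set V) : Prop :=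
  A.Nonempty ∧ A ≠ Set.univ ∧ (omegaMinus R A).ncard = arcConnectivity R

/-- An arc fragment: a positive or negative arc fragment. -/
def IsArcFragment {V : Type*} (R : V → V → Prop) (A : Set V) : Prop :=
  IsPosFragment R A ∨ IsNegFragment R A

/-- A `λ`-atom: an arc fragment of least possible cardinality. -/
def IsLambdaAtom {V : Type*} (R : V → V → Prop) (A : Set V) : Prop :=
  IsArcFragment R A ∧ ∀ B, IsArcFragment R B → A.ncard ≤ B.ncard

/-- A positive `λ`-atom: a positive arc fragment of least possible cardinality
among all arc fragments. -/
def IsPosLambdaAtom {V : Type*} (R : V → V → Prop) (A : Set V) : Prop :=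
  IsPosFragment R A ∧ ∀ B, IsArcFragment R B → A.ncard ≤ B.ncard

/-- A negative `λ`-atom: a negative arc fragment of least possible cardinality
among all arc fragments. -/
def IsNegLambdaAtom {V : Type*} (R : V → V → Prop) (A : Set V) : Prop :=
  IsNegFragment R A ∧ ∀ B, IsArcFragment R B → A.ncard ≤ B.ncard

/-- A `λ`-superatom: an arc fragment with at least two vertices, of least
possible cardinality among arc fragments with at least two vertices. -/
def IsLambdaSuperatom {V : Type*} (R : V → V → Prop) (A : Set V) : Prop :=
  IsArcFragment R A ∧ 2 ≤ A.ncard ∧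
    ∀ B, IsArcFragment R B → 2 ≤ B.ncard → A.ncard ≤ B.ncard

/-- A positive `λ`-superatom. -/
def IsPosLambdaSuperatom {V : Type*} (R : V → V → Prop) (A : Set V) : Prop :=
  IsPosFragment R A ∧ 2 ≤ A.ncard ∧
    ∀ B, IsArcFragment R B → 2 ≤ B.ncard → A.ncard ≤ B.ncard

/-- A negative `λ`-superatom. -/
def IsNegLambdaSuperatom {V : Type*} (R : V → V → Prop) (A : Set V) : Prop :=
  IsNegFragment R A ∧ 2 ≤ A.ncard ∧
    ∀ B, IsArcFragment R B → 2 ≤ B.ncard → A.ncard ≤ B.ncard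

/-- The set of out-arcs of a vertex. -/
def outArcsOf {V : Type*} (R : V → V → Prop) (v : V) : Set (V × V) :=
  {p | R p.1 p.2 ∧ p.1 = v}

/-- The set of in-arcs of a vertex. -/
def inArcsOf {V : Type*} (R : V → V → Prop) (v : V) : Set (V × V) :=
  {p | R p.1 p.2 ∧ p.2 = v}

/-- A digraph is super-`λ` if every minimum arc-disconnecting set is the set of
in-arcs of some vertex or the set of out-arcs of some vertex. -/
def SuperLambda {V : Type*} (R : V → V → Prop) : Prop :=
  ∀ W : Set (V × V), IsDisconnectingArcSet R W → W.ncard = arcConnectivity R →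
    (∃ v, W = outArcsOf R v) ∨ (∃ v, W = inArcsOf R v)

section DigraphCuts

variable {V : Type*} (R : V → V → Prop)

lemma omegaMinus_eq_omegaPlus_compl (A : Set V) : omegaMinus R A = omegaPlus R Aᶜ := by
  ext p
  simp [omegaMinus, omegaPlus]

lemma ncard_omegaPlus_flip (A : Set V) :
    (omegaPlus (flip R) A).ncard = (omegaMinus R A).ncard := by
  rw [← Set.ncard_image_of_injective (omegaMinus R A) Prod.swap_injective]
  congr 1
  ext ⟨a, b⟩
  simp only [omegaPlus, omegaMinus, flip, Set.image_swap_eq_preimage_swap, Set.mem_preimage,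
    Set.mem_ofPred_eq, Prod.swap_prod_mk]
  tauto

lemma ncard_omegaPlus_image {R} (e : V ≃ V) (he : ∀ u v, R (e u) (e v) ↔ R u v) (A : Set V) :
    (omegaPlus R (e '' A)).ncard = (omegaPlus R A).ncard := by
  rw [← Set.ncard_image_of_injective (omegaPlus R A) (e.prodCongr e).injective]
  congr 1
  ext ⟨a, b⟩
  obtain ⟨a, rfl⟩ := e.surjective a
  obtain ⟨b, rfl⟩ := e.surjective b
  simp [omegaPlus, he, Prod.ext_iff]

lemma ncard_omegaMinus_image {R} (e : V ≃ V) (he : ∀ u v, R (e u) (e v) ↔ R u v) (A : Set V) :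
    (omegaMinus R (e '' A)).ncard = (omegaMinus R A).ncard := by
  rw [omegaMinus_eq_omegaPlus_compl, omegaMinus_eq_omegaPlus_compl,
    ← Set.image_compl_eq e.bijective, ncard_omegaPlus_image e he]

lemma isPosFragment_image {R} (e : V ≃ V) (he : ∀ u v, R (e u) (e v) ↔ R u v) {A : Set V}
    (hA : IsPosFragment R A) : IsPosFragment R (e '' A) :=
  ⟨hA.1.image e, fun h => hA.2.1 (Set.image_injective.2 e.injective (by simp [h])),
    (ncard_omegaPlus_image e he A).trans hA.2.2⟩

lemma isNegFragment_image {R} (e : V ≃ V) (he : ∀ u v, R (e u) (e v) ↔ R u v) {A : Set V}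
    (hA : IsNegFragment R A) : IsNegFragment R (e '' A) :=
  ⟨hA.1.image e, fun h => hA.2.1 (Set.image_injective.2 e.injective (by simp [h])),
    (ncard_omegaMinus_image e he A).trans hA.2.2⟩

lemma arcConnectivity_le_ncard_omegaPlus {A : Set V} (hA : A.Nonempty) (hA' : A ≠ Set.univ) :
    arcConnectivity R ≤ (omegaPlus R A).ncard := by
  refine Nat.sInf_le ⟨omegaPlus R A, ⟨fun p hp => hp.1, fun hsc => ?_⟩, rfl⟩
  obtain ⟨a, ha⟩ := hA
  obtain ⟨b, hb⟩ := (Set.ne_univ_iff_exists_notMem A).1 hA'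
  have hreach := hsc a b
  revert hb
  rw [imp_false, not_not]
  induction hreach with
  | refl => exact ha
  | tail _ huv ih =>
    by_contra hv
    exact huv.2 ⟨huv.1, ih, hv⟩

lemma arcConnectivity_le_ncard_omegaMinus {A : Set V} (hA : A.Nonempty) (hA' : A ≠ Set.univ) :
    arcConnectivity R ≤ (omegaMinus R A).ncard := by
  rw [omegaMinus_eq_omegaPlus_compl]
  exact arcConnectivity_le_ncard_omegaPlus R (Set.nonempty_compl.2 hA')
    (by simpa [Set.compl_univ_iff] using hA.ne_empty)

lemma minDegree_le_outDegree (v : V) : minDegree R ≤ outDegree R v :=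
  Nat.sInf_le ⟨v, Or.inl rfl⟩

lemma minDegree_le_inDegree (v : V) : minDegree R ≤ inDegree R v :=
  Nat.sInf_le ⟨v, Or.inr rfl⟩

lemma isArcFragment_compl {A : Set V} (hA : IsArcFragment R A) : IsArcFragment R Aᶜ := by
  rcases hA with ⟨h1, h2, h3⟩ | ⟨h1, h2, h3⟩
  · refine Or.inr ⟨Set.nonempty_compl.2 h2, by simpa using h1.ne_empty, ?_⟩
    rw [omegaMinus_eq_omegaPlus_compl, compl_compl, h3]
  · refine Or.inl ⟨Set.nonempty_compl.2 h2, by simpa using h1.ne_empty, ?_⟩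
    rw [← omegaMinus_eq_omegaPlus_compl, h3]

variable [Finite V]

lemma ncard_omegaPlus_submodular (A B : Set V) :
    (omegaPlus R (A ∩ B)).ncard + (omegaPlus R (A ∪ B)).ncard ≤
      (omegaPlus R A).ncard + (omegaPlus R B).ncard := by
  rw [← Set.ncard_union_add_ncard_inter (omegaPlus R (A ∩ B)),
    ← Set.ncard_union_add_ncard_inter (omegaPlus R A)]
  refine add_le_add (Set.ncard_le_ncard ?_) (Set.ncard_le_ncard ?_) <;>
  · intro p
    simp only [omegaPlus, Set.mem_union, Set.mem_inter_iff, Set.mem_ofPred_eq]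
    tauto

lemma ncard_omegaMinus_submodular (A B : Set V) :
    (omegaMinus R (A ∩ B)).ncard + (omegaMinus R (A ∪ B)).ncard ≤
      (omegaMinus R A).ncard + (omegaMinus R B).ncard := by
  simpa only [ncard_omegaPlus_flip] using ncard_omegaPlus_submodular (flip R) A B

lemma disjoint_of_submodular_of_minimal {f : Set V → ℕ} {c : ℕ}
    (hsub : ∀ A B, f (A ∩ B) + f (A ∪ B) ≤ f A + f B)
    (hle : ∀ A : Set V, A.Nonempty → A ≠ Set.univ → c ≤ f A)
    {A B : Set V} (hA : f A = c) (hB : f B = c) (hAB : A.ncard = B.ncard)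
    (huniv : A ≠ Set.univ)
    (hmin : ∀ C : Set V, C.Nonempty → C ≠ Set.univ → f C = c → A.ncard ≤ C.ncard)
    (hhalf : A.ncard ≤ Aᶜ.ncard) (hne : A ≠ B) : Disjoint A B := by
  by_contra hdis
  have hinter : (A ∩ B).Nonempty := Set.not_disjoint_iff_nonempty_inter.1 hdis
  have hinter' : A ∩ B ≠ Set.univ := fun h =>
    huniv (Set.univ_subset_iff.1 (h ▸ Set.inter_subset_left))
  have hunion : A ∪ B ≠ Set.univ := by
    intro h
    have h1 := Set.ncard_union_add_ncard_inter A B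
    have h2 := Set.ncard_add_ncard_compl A
    have h3 := (Set.ncard_pos).2 hinter
    rw [h, Set.ncard_univ] at h1
    omega
  have h1 := hsub A B
  have h2 := hle _ hinter hinter'
  have h3 := hle _ (hinter.mono (Set.inter_subset_left.trans Set.subset_union_left)) hunion
  have h4 := hmin _ hinter hinter' (by omega)
  have h5 : A ∩ B = A := Set.eq_of_subset_of_ncard_le Set.inter_subset_left h4
  exact hne (Set.eq_of_subset_of_ncard_le (Set.inter_eq_left.1 h5) hAB.ge)

lemma IsLambdaAtom.image_eq_or_disjoint {R} {A : Set V} (hA : IsLambdaAtom R A) (e : V ≃ V)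
    (he : ∀ u v, R (e u) (e v) ↔ R u v) : A = e '' A ∨ Disjoint A (e '' A) := by
  refine or_iff_not_imp_left.2 fun hne => ?_
  have hcard := (Set.ncard_image_of_injective A e.injective).symm
  have hhalf := hA.2 _ (isArcFragment_compl R hA.1)
  rcases hA with ⟨h | h, hmin⟩
  · exact disjoint_of_submodular_of_minimal (ncard_omegaPlus_submodular R)
      (fun _ => arcConnectivity_le_ncard_omegaPlus R) h.2.2 (isPosFragment_image e he h).2.2
      hcard h.2.1 (fun C h1 h2 h3 => hmin C (Or.inl ⟨h1, h2, h3⟩)) hhalf hne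
  · exact disjoint_of_submodular_of_minimal (ncard_omegaMinus_submodular R)
      (fun _ => arcConnectivity_le_ncard_omegaMinus R) h.2.2 (isNegFragment_image e he h).2.2
      hcard h.2.1 (fun C h1 h2 h3 => hmin C (Or.inr ⟨h1, h2, h3⟩)) hhalf hne

lemma ncard_setOf_fst_mem (A : Set V) (Q : V → V → Prop) :
    {p : V × V | p.1 ∈ A ∧ Q p.1 p.2}.ncard = ∑ᶠ v ∈ A, {w | Q v w}.ncard := by
  classical
  have := Fintype.ofFinite V
  rw [finsum_mem_eq_toFinset_sum, Set.ncard_eq_toFinset_card',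
    Finset.card_eq_sum_card_fiberwise (f := Prod.fst) (t := A.toFinset)
      (fun p hp => by simp at hp ⊢; exact hp.1)]
  refine Finset.sum_congr rfl fun v hv => ?_
  rw [Set.mem_toFinset] at hv
  rw [Set.ncard_eq_toFinset_card', ← Finset.card_map (s := {w | Q v w}.toFinset)
    ⟨fun w => (v, w), Prod.mk_right_injective v⟩]
  congr 1
  ext ⟨a, b⟩
  simp only [Finset.mem_filter, Set.mem_toFinset, Set.mem_ofPred_eq, Finset.mem_map,
    Function.Embedding.coeFn_mk, Prod.mk.injEq]
  constructor
  · rintro ⟨⟨h1, h2⟩, rfl⟩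
    exact ⟨b, h2, rfl, rfl⟩
  · rintro ⟨w, hw, rfl, rfl⟩
    exact ⟨⟨hv, hw⟩, rfl⟩

lemma le_ncard_omegaPlus_of_forall_exists {A : Set V} (hA : A.Nonempty) {d : ℕ}
    (hloop : ∀ v, ¬ R v v) (hout : ∀ v ∈ A, ∃ w ∉ A, R v w) (hd : ∀ v ∈ A, d ≤ outDegree R v) :
    d ≤ (omegaPlus R A).ncard := by
  classical
  have := Fintype.ofFinite V
  have hsum : (omegaPlus R A).ncard = ∑ᶠ v ∈ A, {w | R v w ∧ w ∉ A}.ncard := by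
    rw [← ncard_setOf_fst_mem]
    congr 1
    ext p
    simp only [omegaPlus, Set.mem_ofPred_eq]
    tauto
  have hone : ∀ v ∈ A, 1 ≤ {w | R v w ∧ w ∉ A}.ncard := by
    intro v hv
    obtain ⟨w, hw, hvw⟩ := hout v hv
    exact (Set.ncard_pos).2 ⟨w, hvw, hw⟩
  have htwo : ∀ v ∈ A, d + 1 ≤ {w | R v w ∧ w ∉ A}.ncard + A.ncard := by
    intro v hv
    have h1 : {w | R v w} ⊆ {w | R v w ∧ w ∉ A} ∪ A \ {v} := by
      intro w hw
      by_cases hwA : w ∈ A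
      · exact Or.inr ⟨hwA, fun h => hloop v (h ▸ hw)⟩
      · exact Or.inl ⟨hw, hwA⟩
    have h2 := (Set.ncard_le_ncard h1).trans (Set.ncard_union_le _ _)
    have h3 := Set.ncard_sdiff_singleton_add_one hv
    have h4 := hd v hv
    rw [outDegree] at h4
    omega
  have hpos := (Set.ncard_pos).2 hA
  have key : ∀ k, (∀ v ∈ A, k ≤ {w | R v w ∧ w ∉ A}.ncard) →
      A.ncard * k ≤ (omegaPlus R A).ncard := by
    intro k hk
    rw [hsum, finsum_mem_eq_toFinset_sum, Set.ncard_eq_toFinset_card', ← smul_eq_mul]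
    exact Finset.card_nsmul_le_sum _ _ _ fun v hv => hk v (Set.mem_toFinset.1 hv)
  rcases le_total d A.ncard with h | h
  · exact h.trans (by simpa using key 1 hone)
  · obtain ⟨k, rfl⟩ := Nat.exists_eq_add_of_le h
    have := key (k + 1) fun v hv => by have := htwo v hv; omega
    nlinarith

lemma ncard_omegaPlus_add_ncard_inside (A : Set V) :
    (omegaPlus R A).ncard + {p : V × V | R p.1 p.2 ∧ p.1 ∈ A ∧ p.2 ∈ A}.ncard =
      ∑ᶠ v ∈ A, outDegree R v := by
  unfold outDegree
  rw [← ncard_setOf_fst_mem, ← Set.ncard_union_eq]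
  · congr 1
    ext p
    simp only [omegaPlus, Set.mem_union, Set.mem_ofPred_eq]
    tauto
  · rw [Set.disjoint_left]
    exact fun p h h' => h.2.2 h'.2.2

lemma ncard_omegaMinus_add_ncard_inside (A : Set V) :
    (omegaMinus R A).ncard + {p : V × V | R p.1 p.2 ∧ p.1 ∈ A ∧ p.2 ∈ A}.ncard =
      ∑ᶠ v ∈ A, inDegree R v := by
  rw [← ncard_omegaPlus_flip]
  refine Eq.trans ?_ (ncard_omegaPlus_add_ncard_inside (flip R) A)
  congr 1
  rw [← Set.ncard_image_of_injective _ Prod.swap_injective]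
  congr 1
  ext ⟨a, b⟩
  simp only [flip, Set.image_swap_eq_preimage_swap, Set.mem_preimage, Set.mem_ofPred_eq,
    Prod.swap_prod_mk]
  tauto

end DigraphCuts

section RightTranslation

variable {G : Type*} [Group G]

/-- Right translation by `h` on both copies of `G`. -/
def rightTranslation (h : G) : G × Bool ≃ G × Bool :=
  (Equiv.mulRight h).prodCongr (Equiv.refl Bool)

@[simp]
lemma rightTranslation_apply (h : G) (p : G × Bool) : rightTranslation h p = (p.1 * h, p.2) :=
  rfl

lemma mdArc_rightTranslation (S0 S1 T0 T1 : Set G) (h : G) (u v : G × Bool) :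
    MDArc S0 S1 T0 T1 (rightTranslation h u) (rightTranslation h v) ↔ MDArc S0 S1 T0 T1 u v := by
  simp [MDArc, ← mul_assoc]

lemma ncard_side_le_of_image_eq_or_disjoint [Finite G] {A : Set (G × Bool)}
    (hA : ∀ h : G, A = rightTranslation h '' A ∨ Disjoint A (rightTranslation h '' A))
    {i j : Bool} {a b : G} (ha : (a, i) ∈ A) (hb : (b, j) ∈ A) :
    (A ∩ {p | p.2 = i}).ncard ≤ (A ∩ {p | p.2 = j}).ncard := by
  refine Set.ncard_le_ncard_of_injOn (fun p => (b * (a⁻¹ * p.1), j)) ?_ ?_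
  · rintro ⟨x, _⟩ ⟨hx, rfl⟩
    refine ⟨?_, rfl⟩
    have h1 := Set.mem_image_of_mem (rightTranslation (a⁻¹ * x)) ha
    rw [rightTranslation_apply, mul_inv_cancel_left] at h1
    rcases hA (a⁻¹ * x) with h | h
    · rw [h]
      exact ⟨_, hb, by simp⟩
    · exact absurd h1 (Set.disjoint_left.1 h hx)
  · rintro ⟨x, _⟩ ⟨_, rfl⟩ ⟨y, _⟩ ⟨_, h⟩ hxy
    simp_all

lemma finsum_mem_eq_of_rightTranslation_invariant [Finite G] {f : G × Bool → ℕ}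
    (hf : ∀ h p, f (rightTranslation h p) = f p) {A : Set (G × Bool)}
    (hA : (A ∩ {p | p.2 = false}).ncard = (A ∩ {p | p.2 = true}).ncard) :
    ∑ᶠ v ∈ A, f v = (A ∩ {p | p.2 = false}).ncard * (f (1, false) + f (1, true)) := by
  have hside : ∀ i : Bool, ∑ᶠ v ∈ A ∩ {p | p.2 = i}, f v =
      (A ∩ {p | p.2 = i}).ncard * f (1, i) := by
    intro i
    classical
    have := Fintype.ofFinite G
    rw [finsum_mem_eq_toFinset_sum, Set.ncard_eq_toFinset_card', ← smul_eq_mul]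
    refine Finset.sum_eq_card_nsmul ?_
    rintro ⟨x, k⟩ hx
    obtain rfl : k = i := (Set.mem_toFinset.1 hx).2
    simpa using hf x (1, k)
  rw [mul_add, ← hside, hA, ← hside, ← finsum_mem_union]
  · congr! with v
    ext v
    cases h : v.2 <;> simp [h]
  · rw [Set.disjoint_left]
    rintro v ⟨_, h⟩ ⟨_, h'⟩
    simp_all
  all_goals exact Set.toFinite _

variable [Finite G] {S0 S1 T0 T1 : Set G}

lemma mdArc_ncard_omegaPlus_eq_ncard_omegaMinus {A : Set (G × Bool)}
    (hA : (A ∩ {p | p.2 = false}).ncard = (A ∩ {p | p.2 = true}).ncard) :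
    (omegaPlus (MDArc S0 S1 T0 T1) A).ncard = (omegaMinus (MDArc S0 S1 T0 T1) A).ncard := by
  set R := MDArc S0 S1 T0 T1 with hR
  have hout : ∀ h p, outDegree R (rightTranslation h p) = outDegree R p := by
    intro h p
    rw [outDegree, outDegree,
      ← Set.ncard_image_of_injective {w | R p w} (rightTranslation h).injective]
    congr 1
    ext w
    obtain ⟨w, rfl⟩ := (rightTranslation h).surjective w
    rw [(rightTranslation h).injective.mem_set_image]
    exact mdArc_rightTranslation S0 S1 T0 T1 h p w
  have hin : ∀ h p, inDegree R (rightTranslation h p) = inDegree R p := by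
    intro h p
    rw [inDegree, inDegree,
      ← Set.ncard_image_of_injective {w | R w p} (rightTranslation h).injective]
    congr 1
    ext w
    obtain ⟨w, rfl⟩ := (rightTranslation h).surjective w
    rw [(rightTranslation h).injective.mem_set_image]
    exact mdArc_rightTranslation S0 S1 T0 T1 h w p
  have huniv : ((Set.univ : Set (G × Bool)) ∩ {p | p.2 = false}).ncard =
      ((Set.univ : Set (G × Bool)) ∩ {p | p.2 = true}).ncard := by
    apply le_antisymm <;>
    exact ncard_side_le_of_image_eq_or_disjoint
      (fun h => Or.inl (Set.image_univ_of_surjective (rightTranslation h).surjective).symm)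
      (Set.mem_univ (1, _)) (Set.mem_univ (1, _))
  have hpos : 0 < ((Set.univ : Set (G × Bool)) ∩ {p | p.2 = false}).ncard :=
    (Set.ncard_pos).2 ⟨(1, false), by simp⟩
  have hdeg : outDegree R (1, false) + outDegree R (1, true) =
      inDegree R (1, false) + inDegree R (1, true) := by
    have h1 := ncard_omegaPlus_add_ncard_inside R Set.univ
    have h2 := ncard_omegaMinus_add_ncard_inside R Set.univ
    rw [finsum_mem_eq_of_rightTranslation_invariant hout huniv] at h1
    rw [finsum_mem_eq_of_rightTranslation_invariant hin huniv] at h2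
    refine Nat.eq_of_mul_eq_mul_left hpos ?_
    rw [← h1, ← h2]
    simp [omegaPlus, omegaMinus]
  have h1 := ncard_omegaPlus_add_ncard_inside R A
  have h2 := ncard_omegaMinus_add_ncard_inside R A
  rw [finsum_mem_eq_of_rightTranslation_invariant hout hA] at h1
  rw [finsum_mem_eq_of_rightTranslation_invariant hin hA, ← hdeg] at h2
  omega

lemma mdArc_exists_mem_side (hS0 : (1 : G) ∉ S0) (hS1 : (1 : G) ∉ S1)
    (hT0 : T0.Nonempty) (hT1 : T1.Nonempty)
    (hlt : arcConnectivity (MDArc S0 S1 T0 T1) < minDegree (MDArc S0 S1 T0 T1))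
    {A : Set (G × Bool)} (hA : IsArcFragment (MDArc S0 S1 T0 T1) A) (i : Bool) :
    ∃ a, (a, i) ∈ A := by
  by_contra! hi
  have hloop : ∀ v, ¬ MDArc S0 S1 T0 T1 v v := by
    rintro ⟨g, _ | _⟩ <;> simpa [MDArc]
  have hne : ∀ v ∈ A, v.2 = !i := by
    rintro ⟨g, k⟩ hv
    by_contra hk
    obtain rfl : k = i := by simpa using hk
    exact hi g hv
  obtain ⟨t0, ht0⟩ := hT0
  obtain ⟨t1, ht1⟩ := hT1
  rcases hA with ⟨h1, -, h2⟩ | ⟨h1, -, h2⟩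
  · refine absurd (le_ncard_omegaPlus_of_forall_exists _ h1 hloop ?_
      fun v _ => minDegree_le_outDegree _ v) (by omega)
    rintro ⟨g, k⟩ hv
    obtain rfl : k = !i := hne _ hv
    cases i
    · exact ⟨(t1⁻¹ * g, false), hi _, by simpa [MDArc] using ⟨t1, ht1, by simp⟩⟩
    · exact ⟨(t0 * g, true), hi _, by simpa [MDArc] using ht0⟩
  · rw [← ncard_omegaPlus_flip] at h2
    refine absurd (le_ncard_omegaPlus_of_forall_exists (flip (MDArc S0 S1 T0 T1)) h1
      (d := minDegree (MDArc S0 S1 T0 T1)) (fun v => hloop v) ?_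
      fun v _ => minDegree_le_inDegree _ v) (by omega)
    rintro ⟨g, k⟩ hv
    obtain rfl : k = !i := hne _ hv
    cases i
    · exact ⟨(t0⁻¹ * g, false), hi _, by simpa [MDArc, flip] using ⟨t0, ht0, by simp⟩⟩
    · exact ⟨(t1 * g, true), hi _, by simpa [MDArc, flip] using ht1⟩

end RightTranslation

/-- the vertex set is a disjoint union of distinct positive
(resp. negative) λ-atoms, and a λ-atom meets both sides in sets of equal size. -/
theorem mixedCayley_lambdaAtoms_partition_and_balanced
    {G : Type*} [Group G] [Fintype G] (S0 S1 T0 T1 : Set G)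
    (hS0 : (1 : G) ∉ S0) (hS1 : (1 : G) ∉ S1)
    (hT0 : T0.Nonempty) (hT1 : T1.Nonempty)
    (hsc : DigraphStronglyConnected (MDArc S0 S1 T0 T1))
    (hlt : arcConnectivity (MDArc S0 S1 T0 T1) < minDegree (MDArc S0 S1 T0 T1))
    (A : Set (G × Bool)) (hA : IsLambdaAtom (MDArc S0 S1 T0 T1) A) :
    (∃ P : Set (Set (G × Bool)),
      (∀ B ∈ P, IsPosLambdaAtom (MDArc S0 S1 T0 T1) B) ∧
      ⋃₀ P = Set.univ ∧ P.Pairwise Disjoint) ∧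
    (∃ P : Set (Set (G × Bool)),
      (∀ B ∈ P, IsNegLambdaAtom (MDArc S0 S1 T0 T1) B) ∧
      ⋃₀ P = Set.univ ∧ P.Pairwise Disjoint) ∧
    (A ∩ {p : G × Bool | p.2 = false}).ncard
      = (A ∩ {p : G × Bool | p.2 = true}).ncard := by
  have he := mdArc_rightTranslation S0 S1 T0 T1
  have hdis := fun h : G => hA.image_eq_or_disjoint (rightTranslation h) (he h)
  have hside := mdArc_exists_mem_side hS0 hS1 hT0 hT1 hlt hA.1
  obtain ⟨a, ha⟩ := hside false
  obtain ⟨b, hb⟩ := hside true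
  have hbal := (ncard_side_le_of_image_eq_or_disjoint hdis ha hb).antisymm
    (ncard_side_le_of_image_eq_or_disjoint hdis hb ha)
  have homega := mdArc_ncard_omegaPlus_eq_ncard_omegaMinus (S0 := S0) (S1 := S1) (T0 := T0)
    (T1 := T1) hbal
  have hposneg : IsPosFragment (MDArc S0 S1 T0 T1) A ∧ IsNegFragment (MDArc S0 S1 T0 T1) A := by
    rcases hA.1 with h | h
    · exact ⟨h, h.1, h.2.1, homega ▸ h.2.2⟩
    · exact ⟨⟨h.1, h.2.1, homega.trans h.2.2⟩, h⟩
  have hmin : ∀ h : G, ∀ B, IsArcFragment (MDArc S0 S1 T0 T1) B →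
      (rightTranslation h '' A).ncard ≤ B.ncard := fun h B hB =>
    (Set.ncard_image_of_injective A (rightTranslation h).injective).trans_le (hA.2 B hB)
  have hcover : ⋃₀ Set.range (fun h : G => rightTranslation h '' A) = Set.univ := by
    refine Set.eq_univ_of_forall ?_
    rintro ⟨g, i⟩
    obtain ⟨c, hc⟩ := hside i
    exact ⟨_, ⟨c⁻¹ * g, rfl⟩, _, hc, by simp⟩
  have hpair : (Set.range (fun h : G => rightTranslation h '' A)).Pairwise Disjoint := by
    rintro _ ⟨h, rfl⟩ _ ⟨k, rfl⟩ hne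
    have hk : rightTranslation k '' A =
        rightTranslation h '' (rightTranslation (k * h⁻¹) '' A) := by
      simp [Set.image_image, mul_assoc, rightTranslation, Prod.map]
    simp only [hk] at hne ⊢
    rcases hdis (k * h⁻¹) with h' | h'
    · exact absurd (congrArg _ h') hne
    · exact (Set.disjoint_image_iff (rightTranslation h).injective).2 h'
  refine ⟨⟨_, ?_, hcover, hpair⟩, ⟨_, ?_, hcover, hpair⟩, hbal⟩
  · rintro _ ⟨h, rfl⟩
    exact ⟨isPosFragment_image _ (he h) hposneg.1, hmin h⟩
  · rintro _ ⟨h, rfl⟩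
    exact ⟨isNegFragment_image _ (he h) hposneg.2, hmin h⟩
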